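/- Let d be a positive integer and f ∈ S̃_d. Then f is a Schwartz function away from 0: f and all its derivatives are rapidly decreasing at ±∞, i.e. for all nonnegative integers m, n, |y|^m |f^{(n)}(y)| is bounded for |y| ≥ 1. -/

import Mathlib

open MeasureTheory Set

/-- Membership in the space `I_d`: `φ` is smooth on `ℝ` and the function
`x ↦ x^{-d-1} φ(-1/x)` (defined for `x ≠ 0`) extends to a smooth function on `ℝ`. -/
def MemI (d : ℕ) (φ : ℝ → ℂ) : Prop :=
  ContDiff ℝ (⊤ : ℕ∞) φ ∧
    ∃ ψ : ℝ → ℂ, ContDiff ℝ (⊤ : ℕ∞) ψ ∧ ∀ x : ℝ, x ≠ 0 → ψ x = ((x : ℂ) ^ (d + 1))⁻¹ * φ (-1 / x)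

/-- The normalized Fourier transform `φ̂(y) = (2π)^{-1/2} ∫_ℝ φ(x) e^{-ixy} dx`. -/
noncomputable def fourierHat (φ : ℝ → ℂ) (y : ℝ) : ℂ :=
  (((2 * Real.pi) ^ (-(1 : ℝ) / 2) : ℝ) : ℂ) * ∫ x : ℝ, φ x * Complex.exp (-(Complex.I * x * y))

/-- The operator `M_d(φ)(y) = |y|^{(1-d)/2} φ̂(y)`. -/
noncomputable def Md (d : ℕ) (φ : ℝ → ℂ) (y : ℝ) : ℂ :=
  ((|y| ^ ((1 - (d : ℝ)) / 2) : ℝ) : ℂ) * fourierHat φ y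

/-- Membership in `S̃_d = M_d(I_d)`, viewed as functions on `ℝ ∖ {0}`:
`f` agrees with `M_d(φ)` away from `0` for some `φ ∈ I_d`. -/
def MemStilde (d : ℕ) (f : ℝ → ℂ) : Prop :=
  ∃ φ : ℝ → ℂ, MemI d φ ∧ ∀ y : ℝ, y ≠ 0 → f y = Md d φ y

/-- Differentiating a function of the form `u ^ a * ψ u` with `u = -1 / x` gains one power of `u`. -/
lemma exists_iteratedDeriv_eq_inv_pow {a : ℕ} {φ ψ : ℝ → ℂ} (hψ : ContDiff ℝ (⊤ : ℕ∞) ψ)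
    (h : ∀ x : ℝ, x ≠ 0 → φ x = ((-x⁻¹ : ℝ) : ℂ) ^ a * ψ (-x⁻¹)) (k : ℕ) :
    ∃ χ : ℝ → ℂ, ContDiff ℝ (⊤ : ℕ∞) χ ∧
      ∀ x : ℝ, x ≠ 0 → iteratedDeriv k φ x = ((-x⁻¹ : ℝ) : ℂ) ^ (a + k) * χ (-x⁻¹) := by
  induction k with
  | zero => exact ⟨ψ, hψ, by simpa using h⟩
  | succ k ih =>
    obtain ⟨χ, hχ, hk⟩ := ih
    refine ⟨fun u ↦ (a + k : ℕ) * χ u + (u : ℂ) * deriv χ u, ?_, fun x hx ↦ ?_⟩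
    · have hd : ContDiff ℝ (⊤ : ℕ∞) (deriv χ) := (contDiff_infty_iff_deriv.1 hχ).2
      exact (contDiff_const.mul hχ).add (Complex.ofRealCLM.contDiff.mul hd)
    · have hev : iteratedDeriv k φ =ᶠ[nhds x]
          fun x ↦ ((-x⁻¹ : ℝ) : ℂ) ^ (a + k) * χ (-x⁻¹) := by
        filter_upwards [isOpen_ne.mem_nhds hx] with z hz using hk z hz
      have hu : HasDerivAt (fun x : ℝ ↦ -x⁻¹) ((-x⁻¹) ^ 2) x := by
        simpa using! (hasDerivAt_inv hx).neg
      have hχ' : HasDerivAt χ (deriv χ (-x⁻¹)) (-x⁻¹) :=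
        (hχ.differentiable (by simp) _).hasDerivAt
      have hd := (hu.ofReal_comp.pow (a + k)).mul (hχ'.scomp x hu)
      rw [iteratedDeriv_succ, hev.deriv_eq]
      refine (hd.deriv).trans ?_
      simp only [Function.comp_apply, Pi.pow_apply, Complex.real_smul]
      generalize (-x⁻¹ : ℝ) = u
      rcases Nat.eq_zero_or_pos (a + k) with h0 | h0
      · simp [← add_assoc, h0]
        ring
      · obtain ⟨b, hb⟩ := Nat.exists_eq_succ_of_ne_zero h0.ne'
        simp only [← add_assoc, hb, Nat.succ_eq_add_one, Nat.add_sub_cancel]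
        push_cast
        ring

/-- A continuous function on `ℝ` of size `O(x⁻²)` away from `[-1, 1]` is integrable. -/
lemma integrable_of_continuous_of_sq_mul_norm_le {g : ℝ → ℂ} (hg : Continuous g) {C : ℝ}
    (hC : ∀ x : ℝ, 1 ≤ |x| → x ^ 2 * ‖g x‖ ≤ C) : Integrable g := by
  obtain ⟨B, hB⟩ := (isCompact_Icc (a := (-1 : ℝ)) (b := 1)).exists_bound_of_continuousOn
    hg.continuousOn
  refine (integrable_inv_one_add_sq.const_mul (2 * max B C)).mono' hg.aestronglyMeasurable
    (.of_forall fun x ↦ ?_)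
  rw [← div_eq_mul_inv, le_div_iff₀ (by positivity)]
  have hn := norm_nonneg (g x)
  rcases le_total |x| 1 with hx | hx
  · have h1 := hB x (abs_le.1 hx)
    have h2 : x ^ 2 ≤ 1 := (sq_le_one_iff_abs_le_one x).2 hx
    nlinarith [le_max_left B C]
  · have h1 := hC x hx
    have h2 : 1 ≤ x ^ 2 := (one_le_sq_iff_one_le_abs x).2 hx
    nlinarith [le_max_right B C]

lemma MemI.contDiff {d : ℕ} {φ : ℝ → ℂ} (hφ : MemI d φ) : ContDiff ℝ (⊤ : ℕ∞) φ := hφ.1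

lemma MemI.comp_neg {d : ℕ} {φ : ℝ → ℂ} (hφ : MemI d φ) : MemI d fun x ↦ φ (-x) := by
  obtain ⟨h1, ψ, h2, h3⟩ := hφ
  refine ⟨h1.comp contDiff_neg, fun x ↦ (-1) ^ (d + 1) * ψ (-x),
    contDiff_const.mul (h2.comp contDiff_neg), fun x hx ↦ ?_⟩
  simp only [h3 (-x) (neg_ne_zero.2 hx), Complex.ofReal_neg]
  rw [neg_pow (x : ℂ), mul_inv, ← mul_assoc, ← mul_assoc, mul_inv_cancel₀ (by simp), one_mul,
    neg_div, neg_div, div_neg, neg_neg]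

lemma MemI.integrable_pow_smul_iteratedDeriv {d : ℕ} (hd : 0 < d) {φ : ℝ → ℂ} (hφ : MemI d φ)
    {j k : ℕ} (hjk : j ≤ k) : Integrable fun x : ℝ ↦ x ^ j • iteratedDeriv k φ x := by
  obtain ⟨h1, ψ, h2, h3⟩ := hφ
  have hinv : ∀ x : ℝ, x ≠ 0 → φ x = ((-x⁻¹ : ℝ) : ℂ) ^ (d + 1) * ψ (-x⁻¹) := by
    intro x hx
    have hx' : (x : ℂ) ≠ 0 := by exact_mod_cast hx
    rw [h3 _ (neg_ne_zero.2 (inv_ne_zero hx)), ← mul_assoc, mul_inv_cancel₀ (by simp [hx]),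
      one_mul]
    congr 1
    field_simp
  obtain ⟨χ, hχ, hk⟩ := exists_iteratedDeriv_eq_inv_pow h2 hinv k
  obtain ⟨B, hB⟩ := (isCompact_Icc (a := (-1 : ℝ)) (b := 1)).exists_bound_of_continuousOn
    hχ.continuous.continuousOn
  have hc : Continuous (iteratedDeriv k φ) := h1.continuous_iteratedDeriv k (by exact_mod_cast le_top)
  refine integrable_of_continuous_of_sq_mul_norm_le ((continuous_pow j).smul hc) (C := B)
    fun x hx ↦ ?_
  have hx0 : 0 < |x| := by linarith
  have hu : |(-x⁻¹)| ≤ 1 := by rw [abs_neg, abs_inv]; exact inv_le_one_of_one_le₀ hx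
  have hB' := hB _ (abs_le.1 hu)
  rw [hk x (abs_pos.1 hx0), norm_smul, norm_mul, norm_pow, norm_pow, Complex.norm_real,
    Real.norm_eq_abs, Real.norm_eq_abs, abs_neg, abs_inv, ← sq_abs, ← mul_assoc, ← mul_assoc,
    ← pow_add, inv_pow, ← div_eq_mul_inv]
  have hle : |x| ^ (2 + j) / |x| ^ (d + 1 + k) ≤ 1 :=
    div_le_one_of_le₀ (pow_le_pow_right₀ hx (by omega)) (by positivity)
  exact (mul_le_of_le_one_left (norm_nonneg _) hle).trans hB'

open FourierTransform in
lemma fourierHat_eq_fourier (φ : ℝ → ℂ) (y : ℝ) :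
    fourierHat φ y = (((2 * Real.pi) ^ (-(1 : ℝ) / 2) : ℝ) : ℂ) * 𝓕 φ ((2 * Real.pi)⁻¹ * y) := by
  rw [fourierHat, Real.fourier_real_eq_integral_exp_smul]
  congr 2 with x
  rw [smul_eq_mul, mul_comm]
  congr 2
  have := Real.pi_ne_zero
  push_cast
  field_simp

lemma fourierHat_comp_neg (φ : ℝ → ℂ) (y : ℝ) :
    fourierHat (fun x ↦ φ (-x)) y = fourierHat φ (-y) := by
  rw [fourierHat, fourierHat, ← integral_neg_eq_self]
  simp

lemma Md_comp_neg (d : ℕ) (φ : ℝ → ℂ) (y : ℝ) :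
    Md d (fun x ↦ φ (-x)) y = Md d φ (-y) := by
  rw [Md, Md, fourierHat_comp_neg, abs_neg]

open FourierTransform in
/-- Away from `0`, the Fourier transform of `φ ∈ I_d` is `y ^ (-N)` times a function of class `C^N`
with bounded derivatives. -/
lemma MemI.exists_fourierHat_eq {d : ℕ} (hd : 0 < d) {φ : ℝ → ℂ} (hφ : MemI d φ) (N : ℕ) :
    ∃ h : ℝ → ℂ, ContDiff ℝ N h ∧ (∀ j ≤ N, ∃ C, ∀ y, ‖iteratedDeriv j h y‖ ≤ C) ∧
      ∀ y : ℝ, y ≠ 0 → fourierHat φ y = ((y ^ N)⁻¹ : ℝ) • h y := by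
  set c : ℂ := (((2 * Real.pi) ^ (-(1 : ℝ) / 2) : ℝ) : ℂ) * (Complex.I ^ N)⁻¹ with hc
  have hint : ∀ n : ℕ, (n : ℕ∞) ≤ (N : ℕ∞) →
      Integrable fun x : ℝ ↦ x ^ n • iteratedDeriv N φ x := fun n hn ↦
    hφ.integrable_pow_smul_iteratedDeriv hd (by exact_mod_cast hn)
  have hF : ContDiff ℝ N (𝓕 (iteratedDeriv N φ)) := by
    refine Real.contDiff_fourier (N := (N : ℕ∞)) fun n hn ↦ ?_
    simpa [norm_smul] using (hint n hn).norm
  have hscale : ContDiff ℝ N fun y : ℝ ↦ 𝓕 (iteratedDeriv N φ) ((2 * Real.pi)⁻¹ * y) :=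
    hF.comp (contDiff_const.mul contDiff_id)
  refine ⟨fun y ↦ c * 𝓕 (iteratedDeriv N φ) ((2 * Real.pi)⁻¹ * y), contDiff_const.mul hscale,
    fun j hj ↦ ?_, fun y hy ↦ ?_⟩
  · refine ⟨‖c‖ * (|(2 * Real.pi)⁻¹| ^ j *
      ∫ x : ℝ, ‖(-2 * Real.pi * Complex.I * x) ^ j • iteratedDeriv N φ x‖), fun y ↦ ?_⟩
    rw [iteratedDeriv_const_mul_field, norm_mul,
      iteratedDeriv_comp_const_smul (hF.of_le (by exact_mod_cast hj)), norm_smul, norm_pow,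
      Real.norm_eq_abs, Real.iteratedDeriv_fourier hint (by exact_mod_cast hj)]
    gcongr
    exact VectorFourier.norm_fourierIntegral_le_integral_norm _ _ _ _ _
  · have hD := congrFun (Real.fourier_iteratedDeriv (N := (N : ℕ∞)) (n := N)
      (hφ.contDiff.of_le (by exact_mod_cast le_top)) (fun n _ ↦ by
        simpa using hφ.integrable_pow_smul_iteratedDeriv hd (Nat.zero_le n)) le_rfl)
      ((2 * Real.pi)⁻¹ * y)
    have hI : (2 * Real.pi * Complex.I * (((2 * Real.pi)⁻¹ * y : ℝ) : ℂ)) = Complex.I * y := by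
      have : (Real.pi : ℂ) ≠ 0 := by exact_mod_cast Real.pi_ne_zero
      push_cast
      field_simp
    have hy' : (y : ℂ) ≠ 0 := by exact_mod_cast hy
    rw [hI] at hD
    beta_reduce
    rw [fourierHat_eq_fourier, hD, hc, Complex.real_smul, smul_eq_mul, mul_pow]
    have := pow_ne_zero N Complex.I_ne_zero
    push_cast
    field_simp

lemma exists_pow_mul_norm_iteratedDeriv_rpow_smul_le {m n : ℕ} {r : ℝ} (hr : r ≤ -m)
    {h : ℝ → ℂ} (hh : ContDiff ℝ n h) (hb : ∀ j ≤ n, ∃ C, ∀ y, ‖iteratedDeriv j h y‖ ≤ C) :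
    ∃ C, ∀ y : ℝ, 1 ≤ y → y ^ m * ‖iteratedDeriv n (fun x : ℝ ↦ x ^ r • h x) y‖ ≤ C := by
  choose! B hB using hb
  refine ⟨∑ i ∈ Finset.range (n + 1),
    n.choose i * (|(descPochhammer ℝ i).eval r| * B (n - i)), fun y hy ↦ ?_⟩
  have hy0 : 0 < y := by linarith
  have hleib := iteratedDerivWithin_smul (n := n) (mem_univ y) uniqueDiffOn_univ
    (Real.contDiffAt_rpow_const_of_ne (p := r) hy0.ne').contDiffWithinAt
    hh.contDiffAt.contDiffWithinAt
  simp only [iteratedDerivWithin_univ] at hleib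
  change y ^ m * ‖iteratedDeriv n ((fun x : ℝ ↦ x ^ r) • h) y‖ ≤ _
  rw [hleib]
  refine (mul_le_mul_of_nonneg_left (norm_sum_le _ _) (by positivity)).trans ?_
  rw [Finset.mul_sum]
  refine Finset.sum_le_sum fun i _ ↦ ?_
  have hpow : y ^ m * y ^ (r - i) ≤ 1 := by
    rw [← Real.rpow_natCast, ← Real.rpow_add hy0]
    exact Real.rpow_le_one_of_one_le_of_nonpos hy (by linarith [(Nat.cast_nonneg i : (0 : ℝ) ≤ i)])
  rw [iteratedDeriv_eq_iterate, Real.iter_deriv_rpow_const, nsmul_eq_mul, norm_mul, norm_smul,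
    norm_mul, Real.norm_eq_abs, Real.norm_eq_abs, abs_of_pos (Real.rpow_pos_of_pos hy0 _),
    Complex.norm_natCast]
  calc y ^ m * (n.choose i * (|(descPochhammer ℝ i).eval r| * y ^ (r - i) *
        ‖iteratedDeriv (n - i) h y‖))
      = y ^ m * y ^ (r - i) * (n.choose i * (|(descPochhammer ℝ i).eval r| *
        ‖iteratedDeriv (n - i) h y‖)) := by ring
    _ ≤ n.choose i * (|(descPochhammer ℝ i).eval r| * ‖iteratedDeriv (n - i) h y‖) :=
        mul_le_of_le_one_left (by positivity) hpow
    _ ≤ _ := by gcongr; exact hB _ (Nat.sub_le n i) y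

lemma MemI.exists_pow_mul_norm_iteratedDeriv_Md_le {d : ℕ} (hd : 0 < d) {φ : ℝ → ℂ}
    (hφ : MemI d φ) (m n : ℕ) :
    ∃ C, ∀ y : ℝ, 1 ≤ y → y ^ m * ‖iteratedDeriv n (Md d φ) y‖ ≤ C := by
  obtain ⟨h, hh, hb, heq⟩ := hφ.exists_fourierHat_eq hd (n + m)
  have hd' : (1 : ℝ) ≤ d := by exact_mod_cast hd
  have hr : (1 - (d : ℝ)) / 2 - (n + m : ℕ) ≤ -m := by
    push_cast
    linarith [(Nat.cast_nonneg n : (0 : ℝ) ≤ n)]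
  obtain ⟨C, hC⟩ := exists_pow_mul_norm_iteratedDeriv_rpow_smul_le hr
    (hh.of_le (by exact_mod_cast Nat.le_add_right n m)) fun j hj ↦ hb j (by omega)
  refine ⟨C, fun y hy ↦ ?_⟩
  have hev : Md d φ =ᶠ[nhds y] fun x ↦ x ^ ((1 - (d : ℝ)) / 2 - (n + m : ℕ)) • h x := by
    filter_upwards [Ioi_mem_nhds (by linarith : 0 < y)] with x hx
    have hx : 0 < x := hx
    rw [Md, heq x hx.ne', abs_of_pos hx, ← Complex.real_smul, smul_smul, Real.rpow_sub hx,
      Real.rpow_natCast, ← div_eq_mul_inv]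
  rw [hev.iteratedDeriv_eq]
  exact hC y hy

/-- every `f ∈ S̃_d` and all its derivatives are rapidly decreasing at
`±∞`: for all `m n`, `|y|^m |f^{(n)}(y)|` is bounded for `|y| ≥ 1`. -/
theorem Stilde_rapidly_decreasing (d : ℕ) (hd : 0 < d) (f : ℝ → ℂ)
    (hf : MemStilde d f) :
    ∀ m n : ℕ, ∃ C : ℝ, ∀ y : ℝ, 1 ≤ |y| → |y| ^ m * ‖iteratedDeriv n f y‖ ≤ C := by
  intro m n
  obtain ⟨φ, hφ, hfφ⟩ := hf
  obtain ⟨C₁, h₁⟩ := hφ.exists_pow_mul_norm_iteratedDeriv_Md_le hd m n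
  obtain ⟨C₂, h₂⟩ := hφ.comp_neg.exists_pow_mul_norm_iteratedDeriv_Md_le hd m n
  refine ⟨max C₁ C₂, fun y hy ↦ ?_⟩
  have hev : f =ᶠ[nhds y] Md d φ := by
    filter_upwards [isOpen_ne.mem_nhds (abs_pos.1 (zero_lt_one.trans_le hy))] with x hx
      using hfφ x hx
  rw [hev.iteratedDeriv_eq]
  rcases le_total 0 y with h0 | h0
  · rw [abs_of_nonneg h0] at hy ⊢
    exact (h₁ y hy).trans (le_max_left _ _)
  · rw [abs_of_nonpos h0] at hy ⊢
    have h := h₂ (-y) hy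
    rw [funext (Md_comp_neg d φ), iteratedDeriv_comp_neg, neg_neg, norm_smul, norm_pow, norm_neg,
      norm_one, one_pow, one_mul] at h
    exact h.trans (le_max_right _ _)
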